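/- Let v ∈ ℂ^n, w ∈ ℤ^n and I ⊆ {1,…,n}, and suppose there exists an index i ∈ I with 1 ≤ i ≤ k such that v_i is a nonnegative integer. Then the set {z ∈ ℤ : I-nsupp(v + w + z·ℓ) = I-nsupp(v)} is bounded below. (The key step in the proof of Theorem 6.5, showing that the series Φ^Q_{v,β+u}(x) involve only finitely many negative powers of x_0 and hence lie in the Nilsson ring ℂ[[x_0]][x_0^{−1}, x^v].) -/

import Mathlib

/-- Key step of Theorem 6.5: if some i ∈ I with i ≤ k has v_i a nonnegative integer,
then {z ∈ ℤ : I-nsupp(v + w + zℓ) = I-nsupp(v)} is bounded below. -/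
theorem stmt_12 (d n k : ℕ) (hd : 1 ≤ d) (hn : 2 ≤ n) (hk1 : 1 ≤ k) (hkn : k ≤ n)
    (a : Fin n → Fin d → ℤ)
    (aR : Fin n → Fin d → ℝ) (haR : ∀ μ i, aR μ i = (a μ i : ℝ))
    (hdim : Module.finrank ℝ (Submodule.span ℝ (Set.range aR)) = n - 1)
    (hindep : ∀ μ₀ : Fin n,
      LinearIndependent ℝ (fun ν : {ν : Fin n // ν ≠ μ₀} => aR ν.1))
    (ℓ : Fin n → ℤ) (hℓpos : ∀ μ, 0 < ℓ μ)
    (ℓs : Fin n → ℤ) (hℓs : ∀ μ : Fin n, ℓs μ = if (μ : ℕ) < k then ℓ μ else -ℓ μ)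
    (hlat : ∀ l : Fin n → ℤ, (∑ μ, l μ • a μ) = 0 ↔ ∃ z : ℤ, l = z • ℓs)
    (v : Fin n → ℂ) (w : Fin n → ℤ) (I : Set (Fin n))
    (hex : ∃ i ∈ I, (i : ℕ) < k ∧ ∃ b : ℕ, v i = (b : ℂ)) :
    ∃ z₀ : ℤ, ∀ z : ℤ,
      ({μ : Fin n | μ ∈ I ∧ ∃ m : ℤ, m < 0 ∧ v μ + ((w μ + z * ℓs μ : ℤ) : ℂ) = (m : ℂ)} =
        {μ : Fin n | μ ∈ I ∧ ∃ m : ℤ, m < 0 ∧ v μ = (m : ℂ)}) → z₀ ≤ z := by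
  obtain ⟨i, hiI, hik, b, hb⟩ := hex
  refine ⟨-((b : ℤ) + |w i|), fun z hz => ?_⟩
  by_contra hlt
  have hlt : z < -((b : ℤ) + |w i|) := not_le.mp hlt
  have h1 : ℓs i = ℓ i := by rw [hℓs, if_pos hik]
  have h2 := hℓpos i
  have h3 := abs_nonneg (w i)
  have h4 := le_abs_self (w i)
  have h5 : (0 : ℤ) ≤ b := Int.natCast_nonneg b
  have h6 : z * ℓ i ≤ z := by nlinarith
  have hmem : i ∈ {μ : Fin n | μ ∈ I ∧ ∃ m : ℤ, m < 0 ∧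
      v μ + ((w μ + z * ℓs μ : ℤ) : ℂ) = (m : ℂ)} := by
    refine ⟨hiI, (b : ℤ) + (w i + z * ℓs i), ?_, ?_⟩
    · rw [h1]; linarith
    · rw [hb]; push_cast; ring
  rw [hz] at hmem
  obtain ⟨_, m, hm, he⟩ := hmem
  rw [hb] at he
  have h7 : (b : ℤ) = m := by exact_mod_cast he
  omega
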